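/- There exist universal constants κ ≥ 1 and c > 0 (independent of d, k, b and of the words) such that for all integers d, k, b ≥ 1, setting N = kb, and for all words I, J over {1,…,d}, the block-diagonal random model satisfies ( E[ ( (1/N)⟨A_I h₀, A_J h₀⟩ − δ_{I,J} )² ] )^{1/2} ≤ (κ(|I|+|J|))!! · c/√b. In particular, for each fixed pair of words the random features (1/√N)A_I h₀ become almost orthonormal in L²(P) as the block size b → ∞. -/

import Mathlib

open MeasureTheory ProbabilityTheory Matrix

noncomputable section

/-- Ordered product of the matrices `A i` along the word `I`
(the identity matrix for the empty word). -/
def wordProd {d : ℕ} {n : Type*} [Fintype n] [DecidableEq n]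
    (A : Fin d → Matrix n n ℝ) (I : List (Fin d)) : Matrix n n ℝ :=
  (I.map A).prod

/-- Kronecker delta of two words: `1` if `I = J`, `0` otherwise. -/
def wordDelta {d : ℕ} (I J : List (Fin d)) : ℝ := if I = J then 1 else 0

/-- Sample space of the block-diagonal random model: the entries of the `k` blocks
`B^i_l ∈ ℝ^{b×b}` for each channel `i`, together with the initial vector `h₀ ∈ ℝ^N`
(`N = k⬝b`, an index `(β, l) : Fin b × Fin k` is coordinate `β` of block `l`). -/
abbrev BlockOmega (d k b : ℕ) : Type :=
  (Fin d → Fin k → Fin b → Fin b → ℝ) × ((Fin b × Fin k) → ℝ)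

/-- The probability measure of the block-diagonal random model: all block entries are
i.i.d. centred Gaussians of variance `1/b`, and the entries of `h₀` are i.i.d.
standard Gaussians, independent of the blocks. -/
def blockMeasure (d k b : ℕ) : Measure (BlockOmega d k b) :=
  (Measure.pi fun _ : Fin d => Measure.pi fun _ : Fin k => Measure.pi fun _ : Fin b =>
      Measure.pi fun _ : Fin b => gaussianReal 0 (1 / b)).prod
    (Measure.pi fun _ : Fin b × Fin k => gaussianReal 0 1)

/-- The channel matrices of the block-diagonal model:
`A^i = BlockDiag(B^i_1, …, B^i_k)`. -/
def blockA {d k b : ℕ} (ω : BlockOmega d k b) (i : Fin d) :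
    Matrix (Fin b × Fin k) (Fin b × Fin k) ℝ :=
  Matrix.blockDiagonal fun l => Matrix.of (ω.1 i l)

/-- The random feature `A_I h₀` associated to a word `I`. -/
def blockFeature {d k b : ℕ} (I : List (Fin d)) (ω : BlockOmega d k b) :
    Fin b × Fin k → ℝ :=
  (wordProd (blockA ω) I).mulVec ω.2

/-- A linear functional `E` on a commutative algebra, together with matrices `X i` whose entries
behave under `E` like independent centred Gaussians of variance `1 / |n|`: integration by parts
holds with respect to derivations `D i x y` dual to the entries. -/
structure GaussianMatrixModel (ι n R : Type*) [DecidableEq ι] [DecidableEq n] [Fintype n]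
    [CommRing R] [Algebra ℝ R] where
  E : R →ₗ[ℝ] ℝ
  X : ι → Matrix n n R
  D : ι → n → n → Derivation ℝ R R
  E_one : E 1 = 1
  D_X : ∀ i j x y z w, D i x y (X j z w) = if j = i ∧ z = x ∧ w = y then 1 else 0
  E_X_mul : ∀ i x y p, E (X i x y * p) = (Fintype.card n : ℝ)⁻¹ * E (D i x y p)

/-- A letter together with a sign; the sign `false` stands for the transposed matrix. -/
abbrev SignedLetter (ι : Type*) := ι × Bool

namespace SignedLetter

variable {ι : Type*}

/-- The same letter with the opposite sign. -/
def opp (a : SignedLetter ι) : SignedLetter ι := (a.1, !a.2)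

/-- The word obtained by formally transposing a word. -/
def bar (W : List (SignedLetter ι)) : List (SignedLetter ι) := (W.map opp).reverse

@[simp] lemma length_bar (W : List (SignedLetter ι)) : (bar W).length = W.length := by simp [bar]

@[simp] lemma bar_nil : bar ([] : List (SignedLetter ι)) = [] := rfl

@[simp] lemma bar_cons (a : SignedLetter ι) (W : List (SignedLetter ι)) :
    bar (a :: W) = bar W ++ [a.opp] := by simp [bar]

/-- The number of positive letters minus the number of negative letters. -/
def deg (W : List (SignedLetter ι)) : ℤ := (W.map fun a => if a.2 then 1 else -1).sum

@[simp] lemma deg_nil : deg ([] : List (SignedLetter ι)) = 0 := rfl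

@[simp] lemma deg_cons (a : SignedLetter ι) (W : List (SignedLetter ι)) :
    deg (a :: W) = (if a.2 then 1 else -1) + deg W := by simp [deg]

@[simp] lemma deg_append (V W : List (SignedLetter ι)) : deg (V ++ W) = deg V + deg W := by
  simp [deg]

@[simp] lemma deg_bar (W : List (SignedLetter ι)) : deg (bar W) = -deg W := by
  induction W with
  | nil => simp [bar]
  | cons a W ih =>
    rw [bar_cons, deg_append, ih]
    rcases a with ⟨i, _ | _⟩ <;> simp [opp]

/-- The number of words of degree zero in a list of words. -/
def weight (Ws : List (List (SignedLetter ι))) : ℕ := Ws.countP fun W => deg W = 0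

@[simp] lemma weight_nil : weight ([] : List (List (SignedLetter ι))) = 0 := rfl

@[simp] lemma weight_cons (W : List (SignedLetter ι)) (Ws : List (List (SignedLetter ι))) :
    weight (W :: Ws) = (if deg W = 0 then 1 else 0) + weight Ws := by
  simp [weight, List.countP_cons, add_comm]

@[simp] lemma weight_append (Vs Ws : List (List (SignedLetter ι))) :
    weight (Vs ++ Ws) = weight Vs + weight Ws := by
  simp [weight]

/-- The total number of letters in a list of words. -/
def size (Ws : List (List (SignedLetter ι))) : ℕ := (Ws.map List.length).sum

@[simp] lemma size_nil : size ([] : List (List (SignedLetter ι))) = 0 := rfl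

@[simp] lemma size_cons (W : List (SignedLetter ι)) (Ws : List (List (SignedLetter ι))) :
    size (W :: Ws) = W.length + size Ws := by simp [size]

@[simp] lemma size_append (Vs Ws : List (List (SignedLetter ι))) :
    size (Vs ++ Ws) = size Vs + size Ws := by simp [size]

lemma deg_nonpos {W : List (SignedLetter ι)} (h : ∀ a ∈ W, a.2 = false) : deg W ≤ 0 := by
  induction W with
  | nil => simp
  | cons a W ih =>
    have := ih fun c hc => h c (List.mem_cons_of_mem _ hc)
    simp [h a]
    omega

/-- The word of positive letters given by an unsigned word. -/
def pos (I : List ι) : List (SignedLetter ι) := I.map fun i => (i, true)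

@[simp] lemma length_pos (I : List ι) : (pos I).length = I.length := by simp [pos]

@[simp] lemma pos_nil : pos ([] : List ι) = [] := rfl

@[simp] lemma pos_cons (i : ι) (I : List ι) : pos (i :: I) = (i, true) :: pos I := rfl

@[simp] lemma deg_pos (I : List ι) : deg (pos I) = I.length := by
  induction I with
  | nil => simp
  | cons i I ih => simp [ih, add_comm]

lemma snd_of_mem_pos {I : List ι} {a : SignedLetter ι} (h : a ∈ pos I) : a.2 = true := by
  obtain ⟨i, -, rfl⟩ := List.mem_map.1 h
  rfl

lemma snd_of_mem_bar_pos {I : List ι} {a : SignedLetter ι} (h : a ∈ bar (pos I)) :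
    a.2 = false := by
  simp only [bar, pos, List.map_map, List.mem_reverse, List.mem_map] at h
  obtain ⟨i, -, rfl⟩ := h
  rfl

end SignedLetter

namespace GaussianMatrixModel

open SignedLetter

section MatrixLemmas

variable {n R : Type*} [CommRing R]

lemma map_derivation_mul [Fintype n] [Algebra ℝ R] (D : Derivation ℝ R R) (A B : Matrix n n R) :
    (A * B).map D = A.map D * B + A * B.map D := by
  ext x y
  simp only [Matrix.map_apply, Matrix.mul_apply, Matrix.add_apply, map_sum, Derivation.leibniz,
    smul_eq_mul, Finset.sum_add_distrib]
  rw [add_comm]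
  simp_rw [mul_comm]

lemma map_derivation_one [DecidableEq n] [Algebra ℝ R] (D : Derivation ℝ R R) :
    (1 : Matrix n n R).map D = 0 := by
  ext x y
  by_cases h : x = y <;> simp [h]

lemma derivation_trace [Fintype n] [Algebra ℝ R] (D : Derivation ℝ R R) (A : Matrix n n R) :
    D A.trace = (A.map D).trace := by
  simp [Matrix.trace]

lemma mul_single_mul_apply [Fintype n] [DecidableEq n] (P S : Matrix n n R) (x y z w : n) :
    (P * Matrix.single x y (1 : R) * S : Matrix n n R) z w = P z x * S y w := by
  simp [Matrix.mul_apply, Matrix.single_apply, ite_and]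

lemma trace_mul_single_mul [Fintype n] [DecidableEq n] (P S : Matrix n n R) (x y : n) :
    (P * Matrix.single x y (1 : R) * S : Matrix n n R).trace = (S * P) y x := by
  simp only [Matrix.trace, Matrix.diag, mul_single_mul_apply, Matrix.mul_apply (M := S)]
  simp_rw [mul_comm]

lemma one_le_card [Fintype n] [Nonempty n] : (1 : ℝ) ≤ Fintype.card n := by
  exact_mod_cast Fintype.card_pos

end MatrixLemmas

variable {ι n R : Type*} [DecidableEq ι] [DecidableEq n] [Fintype n] [CommRing R] [Algebra ℝ R]
  (M : GaussianMatrixModel ι n R)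

/-- The matrix of a signed letter. -/
def mat (a : SignedLetter ι) : Matrix n n R := if a.2 then M.X a.1 else (M.X a.1)ᵀ

/-- The derivation dual to the entry `(x, y)` of `M.mat a`. -/
def der (a : SignedLetter ι) (x y : n) : Derivation ℝ R R :=
  if a.2 then M.D a.1 x y else M.D a.1 y x

/-- The ordered product of the matrices of a signed word. -/
def wmat (W : List (SignedLetter ι)) : Matrix n n R := (W.map M.mat).prod

/-- The product of the traces of a list of signed words. -/
def traceProd (Ws : List (List (SignedLetter ι))) : R := (Ws.map fun W => (M.wmat W).trace).prod

@[simp] lemma wmat_nil : M.wmat [] = 1 := rfl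

@[simp] lemma wmat_cons (a : SignedLetter ι) (W : List (SignedLetter ι)) :
    M.wmat (a :: W) = M.mat a * M.wmat W := by simp [wmat]

@[simp] lemma wmat_append (V W : List (SignedLetter ι)) :
    M.wmat (V ++ W) = M.wmat V * M.wmat W := by simp [wmat]

@[simp] lemma mat_opp (a : SignedLetter ι) : M.mat a.opp = (M.mat a)ᵀ := by
  rcases a with ⟨i, _ | _⟩ <;> simp [mat, opp]

@[simp] lemma wmat_bar (W : List (SignedLetter ι)) : M.wmat (bar W) = (M.wmat W)ᵀ := by
  induction W with
  | nil => simp [bar]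
  | cons a W ih =>
    simp [ih]

@[simp] lemma traceProd_nil : M.traceProd [] = 1 := rfl

@[simp] lemma traceProd_cons (W : List (SignedLetter ι)) (Ws : List (List (SignedLetter ι))) :
    M.traceProd (W :: Ws) = (M.wmat W).trace * M.traceProd Ws := by simp [traceProd]

lemma E_mat_mul (a : SignedLetter ι) (x y : n) (p : R) :
    M.E (M.mat a x y * p) = (Fintype.card n : ℝ)⁻¹ * M.E (M.der a x y p) := by
  rcases a with ⟨i, _ | _⟩ <;> simp [mat, der, M.E_X_mul]

lemma map_der_mat (a c : SignedLetter ι) (x y : n) :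
    (M.mat c).map (M.der a x y) =
      if c = a then Matrix.single x y 1 else if c = a.opp then Matrix.single y x 1 else 0 := by
  rcases a with ⟨i, s⟩
  rcases c with ⟨j, t⟩
  ext z w
  rcases eq_or_ne i j with rfl | h
  · cases s <;> cases t <;>
      simp [mat, der, opp, M.D_X, Matrix.single_apply, eq_comm, and_comm]
  · cases s <;> cases t <;> simp [mat, der, opp, M.D_X, h.symm]

/-- Integration by parts in the first letter of a trace. -/
lemma E_trace_mat_mul (a : SignedLetter ι) (W : Matrix n n R) (Q : R) :
    M.E ((M.mat a * W).trace * Q) = (Fintype.card n : ℝ)⁻¹ *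
      (∑ x, ∑ y, M.E ((W.map (M.der a x y)) y x * Q) +
        ∑ x, ∑ y, M.E (W y x * M.der a x y Q)) := by
  have : (M.mat a * W).trace * Q = ∑ x, ∑ y, M.mat a x y * (W y x * Q) := by
    simp [Matrix.trace, Matrix.mul_apply, Finset.sum_mul, mul_assoc]
  simp only [this, map_sum, E_mat_mul, Derivation.leibniz, smul_eq_mul, map_add,
    ← Finset.mul_sum, Finset.sum_add_distrib, Matrix.map_apply]
  rw [add_comm]
  simp_rw [mul_comm Q]

lemma sum_der_mat (a c : SignedLetter ι) (P S : Matrix n n R) (Q : R) :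
    ∑ x, ∑ y, M.E ((P * (M.mat c).map (M.der a x y) * S : Matrix n n R) y x * Q) =
      if c = a then M.E ((Pᵀ * S).trace * Q)
      else if c = a.opp then M.E (P.trace * S.trace * Q) else 0 := by
  simp only [map_der_mat]
  split_ifs
  · simp only [mul_single_mul_apply, ← map_sum, ← Finset.sum_mul]
    simp [Matrix.trace, Matrix.mul_apply]
  · simp only [mul_single_mul_apply, ← map_sum, ← Finset.sum_mul]
    simp only [Matrix.trace, Matrix.diag, Finset.mul_sum]
  · simp

lemma sum_mul_trace_der_mat (a c : SignedLetter ι) (W P S : Matrix n n R) (Q : R) :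
    ∑ x, ∑ y, M.E (W y x * ((P * (M.mat c).map (M.der a x y) * S : Matrix n n R).trace * Q)) =
      if c = a then M.E ((Wᵀ * (S * P)).trace * Q)
      else if c = a.opp then M.E ((W * (S * P)).trace * Q) else 0 := by
  simp only [map_der_mat, ← mul_assoc]
  split_ifs
  · simp only [trace_mul_single_mul, ← map_sum, ← Finset.sum_mul]
    simp [Matrix.trace, Matrix.mul_apply (M := Wᵀ), mul_assoc]
  · simp only [trace_mul_single_mul, ← map_sum, ← Finset.sum_mul]
    rw [Finset.sum_comm]
    simp [Matrix.trace, Matrix.mul_apply (M := W), mul_assoc]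
  · simp

lemma abs_sum_der_wmat_le (a : SignedLetter ι) (Z : Matrix n n R) (Q : R) {B : ℝ} (hB : 0 ≤ B)
    (V : List (SignedLetter ι)) (P : Matrix n n R)
    (same : ∀ V₁ V₂, V = V₁ ++ a :: V₂ →
      |M.E (((P * M.wmat V₁)ᵀ * (M.wmat V₂ * Z)).trace * Q)| ≤ B)
    (opposite : ∀ V₁ V₂, V = V₁ ++ a.opp :: V₂ →
      |M.E ((P * M.wmat V₁).trace * (M.wmat V₂ * Z).trace * Q)| ≤ B) :
    |∑ x, ∑ y, M.E ((P * (M.wmat V).map (M.der a x y) * Z : Matrix n n R) y x * Q)|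
      ≤ V.length * B := by
  induction V generalizing P with
  | nil => simp [map_derivation_one]
  | cons c V ih =>
    have key : ∑ x, ∑ y, M.E ((P * (M.wmat (c :: V)).map (M.der a x y) * Z : Matrix n n R) y x * Q)
        = ∑ x, ∑ y, M.E ((P * (M.mat c).map (M.der a x y) * (M.wmat V * Z) : Matrix n n R) y x * Q)
        + ∑ x, ∑ y, M.E (((P * M.mat c) * (M.wmat V).map (M.der a x y) * Z : Matrix n n R) y x
          * Q) := by
      simp only [← Finset.sum_add_distrib, ← map_add, ← add_mul, ← Matrix.add_apply, wmat_cons,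
        map_derivation_mul]
      simp only [mul_add, mul_assoc, add_mul (R := Matrix n n R)]
    have h₁ := ih (P * M.mat c)
      (fun V₁ V₂ h => by simpa [mul_assoc] using same (c :: V₁) V₂ (by simp [h]))
      (fun V₁ V₂ h => by simpa [mul_assoc] using opposite (c :: V₁) V₂ (by simp [h]))
    have h₂ : |∑ x, ∑ y, M.E ((P * (M.mat c).map (M.der a x y) * (M.wmat V * Z) : Matrix n n R) y x
        * Q)| ≤ B := by
      rw [sum_der_mat]
      split_ifs with h h'
      · simpa using same [] V (by simp [h])
      · simpa using opposite [] V (by simp [h'])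
      · simpa using hB
    rw [key]
    calc _ ≤ B + V.length * B := (abs_add_le _ _).trans (add_le_add h₂ h₁)
      _ = _ := by push_cast [List.length_cons]; ring

lemma abs_sum_mul_trace_der_wmat_le (a : SignedLetter ι) (W : Matrix n n R) (Q : R) {B : ℝ}
    (hB : 0 ≤ B) (V : List (SignedLetter ι)) (P : Matrix n n R)
    (same : ∀ V₁ V₂, V = V₁ ++ a :: V₂ →
      |M.E ((Wᵀ * (M.wmat V₂ * (P * M.wmat V₁))).trace * Q)| ≤ B)
    (opposite : ∀ V₁ V₂, V = V₁ ++ a.opp :: V₂ →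
      |M.E ((W * (M.wmat V₂ * (P * M.wmat V₁))).trace * Q)| ≤ B) :
    |∑ x, ∑ y, M.E (W y x * ((P * (M.wmat V).map (M.der a x y) : Matrix n n R).trace * Q))|
      ≤ V.length * B := by
  induction V generalizing P with
  | nil => simp [map_derivation_one]
  | cons c V ih =>
    have key : ∑ x, ∑ y, M.E (W y x *
          ((P * (M.wmat (c :: V)).map (M.der a x y) : Matrix n n R).trace * Q))
        = ∑ x, ∑ y, M.E (W y x *
          ((P * (M.mat c).map (M.der a x y) * M.wmat V : Matrix n n R).trace * Q))
        + ∑ x, ∑ y, M.E (W y x *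
          (((P * M.mat c) * (M.wmat V).map (M.der a x y) : Matrix n n R).trace * Q)) := by
      simp only [← Finset.sum_add_distrib, ← map_add, ← add_mul, ← mul_add, ← Matrix.trace_add,
        wmat_cons, map_derivation_mul]
      simp only [mul_add, mul_assoc]
    have h₁ := ih (P * M.mat c)
      (fun V₁ V₂ h => by simpa [mul_assoc] using same (c :: V₁) V₂ (by simp [h]))
      (fun V₁ V₂ h => by simpa [mul_assoc] using opposite (c :: V₁) V₂ (by simp [h]))
    have h₂ : |∑ x, ∑ y, M.E (W y x *
          ((P * (M.mat c).map (M.der a x y) * M.wmat V : Matrix n n R).trace * Q))| ≤ B := by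
      rw [sum_mul_trace_der_mat]
      split_ifs with h h'
      · simpa using same [] V (by simp [h])
      · simpa using opposite [] V (by simp [h'])
      · simpa using hB
    rw [key]
    calc _ ≤ B + V.length * B := (abs_add_le _ _).trans (add_le_add h₂ h₁)
      _ = _ := by push_cast [List.length_cons]; ring

lemma abs_sum_mul_der_traceProd_le (a : SignedLetter ι) (W : Matrix n n R) {B : ℝ} (hB : 0 ≤ B)
    (Vs : List (List (SignedLetter ι))) (Q : R)
    (same : ∀ Vs₁ V₁ V₂ Vs₂, Vs = Vs₁ ++ (V₁ ++ a :: V₂) :: Vs₂ →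
      |M.E ((Wᵀ * (M.wmat V₂ * M.wmat V₁)).trace * (Q * M.traceProd (Vs₁ ++ Vs₂)))| ≤ B)
    (opposite : ∀ Vs₁ V₁ V₂ Vs₂, Vs = Vs₁ ++ (V₁ ++ a.opp :: V₂) :: Vs₂ →
      |M.E ((W * (M.wmat V₂ * M.wmat V₁)).trace * (Q * M.traceProd (Vs₁ ++ Vs₂)))| ≤ B) :
    |∑ x, ∑ y, M.E (W y x * (M.der a x y (M.traceProd Vs) * Q))| ≤ size Vs * B := by
  induction Vs generalizing Q with
  | nil => simp
  | cons V Vs ih =>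
    have key : ∑ x, ∑ y, M.E (W y x * (M.der a x y (M.traceProd (V :: Vs)) * Q))
        = ∑ x, ∑ y, M.E (W y x * ((1 * (M.wmat V).map (M.der a x y) : Matrix n n R).trace *
            (Q * M.traceProd Vs)))
        + ∑ x, ∑ y, M.E (W y x * (M.der a x y (M.traceProd Vs) * (Q * (M.wmat V).trace))) := by
      simp only [← Finset.sum_add_distrib, ← map_add]
      refine Finset.sum_congr rfl fun x _ => Finset.sum_congr rfl fun y _ => congrArg M.E ?_
      simp only [traceProd_cons, Derivation.leibniz, smul_eq_mul, derivation_trace, one_mul]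
      ring
    have h₁ := ih (Q * (M.wmat V).trace)
      (fun Vs₁ V₁ V₂ Vs₂ h => by
        simpa [mul_assoc] using same (V :: Vs₁) V₁ V₂ Vs₂ (by simp [h]))
      (fun Vs₁ V₁ V₂ Vs₂ h => by
        simpa [mul_assoc] using opposite (V :: Vs₁) V₁ V₂ Vs₂ (by simp [h]))
    have h₂ := M.abs_sum_mul_trace_der_wmat_le a W (Q * M.traceProd Vs) hB V 1
      (fun V₁ V₂ h => by simpa using same [] V₁ V₂ Vs (by simp [h]))
      (fun V₁ V₂ h => by simpa using opposite [] V₁ V₂ Vs (by simp [h]))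
    rw [key]
    calc _ ≤ V.length * B + size Vs * B := (abs_add_le _ _).trans (add_le_add h₂ h₁)
      _ = _ := by push_cast [size_cons]; ring

section Bounds

variable [Nonempty n]

/-- The expectation of the terms produced when integrating by parts against other traces. -/
lemma abs_sum_mul_der_traceProd_le_pow (a : SignedLetter ι) (W : List (SignedLetter ι))
    (Ws : List (List (SignedLetter ι)))
    (h : ∀ Vs : List (List (SignedLetter ι)), size Vs + 2 = W.length + 1 + size Ws →
      |M.E (M.traceProd Vs)| ≤
        (W.length + size Ws - 1).doubleFactorial * (Fintype.card n : ℝ) ^ weight Vs) :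
    |∑ x, ∑ y, M.E (M.wmat W y x * M.der a x y (M.traceProd Ws))| ≤
      size Ws * ((W.length + size Ws - 1).doubleFactorial *
        (Fintype.card n : ℝ) ^ (weight Ws + 1)) := by
  have h1 := one_le_card (n := n)
  have main (U : List (SignedLetter ι)) (Vs : List (List (SignedLetter ι)))
      (hU : size (U :: Vs) + 2 = W.length + 1 + size Ws) (hw : weight Vs ≤ weight Ws) :
      |M.E ((M.wmat U).trace * M.traceProd Vs)| ≤
        (W.length + size Ws - 1).doubleFactorial * (Fintype.card n : ℝ) ^ (weight Ws + 1) := by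
    rw [← traceProd_cons]
    refine (h _ hU).trans ?_
    gcongr ?_ * ?_
    refine pow_le_pow_right₀ h1 ?_
    rw [weight_cons]
    split_ifs <;> omega
  have := M.abs_sum_mul_der_traceProd_le a (M.wmat W)
    (B := (W.length + size Ws - 1).doubleFactorial * (Fintype.card n : ℝ) ^ (weight Ws + 1))
    (by positivity) Ws 1 (fun Vs₁ V₁ V₂ Vs₂ hV => ?_) (fun Vs₁ V₁ V₂ Vs₂ hV => ?_)
  · simpa using this
  · simpa using main (bar W ++ (V₂ ++ V₁)) (Vs₁ ++ Vs₂) (by simp [hV]; omega) (by simp [hV])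
  · simpa using main (W ++ (V₂ ++ V₁)) (Vs₁ ++ Vs₂) (by simp [hV]; omega) (by simp [hV])

/-- Each trace of a word of degree zero contributes at most one factor `|n|`. -/
theorem abs_E_traceProd_le (Ws : List (List (SignedLetter ι))) :
    |M.E (M.traceProd Ws)| ≤
      (size Ws).doubleFactorial * (Fintype.card n : ℝ) ^ weight Ws := by
  have h1 := one_le_card (n := n)
  induction hN : size Ws using Nat.strong_induction_on generalizing Ws with
  | _ N ih =>
  subst hN
  induction Ws with
  | nil => simp [M.E_one]
  | cons W Ws ihW =>
    cases W with
    | nil =>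
      have := ihW (by simpa using ih)
      simp only [traceProd_cons, wmat_nil, Matrix.trace_one, size_cons, List.length_nil, zero_add,
        weight_cons, deg_nil, if_true]
      rw [← nsmul_eq_mul, map_nsmul, nsmul_eq_mul, abs_mul, Nat.abs_cast, pow_add, pow_one]
      exact (mul_le_mul_of_nonneg_left this (by positivity)).trans_eq (by ring)
    | cons a W =>
      clear ihW
      set w := weight ((a :: W) :: Ws) with hw
      set F : ℝ := ((W.length + size Ws - 1).doubleFactorial : ℝ) with hF
      have hlt (Vs : List (List (SignedLetter ι))) (hV : size Vs + 2 = W.length + 1 + size Ws) :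
          |M.E (M.traceProd Vs)| ≤ F * (Fintype.card n : ℝ) ^ weight Vs := by
        have := ih (size Vs) (by simp; omega) Vs rfl
        rwa [show size Vs = W.length + size Ws - 1 by omega] at this
      have hle (Vs : List (List (SignedLetter ι))) (hV : size Vs + 2 = W.length + 1 + size Ws)
          (hv : weight Vs ≤ w + 1) :
          |M.E (M.traceProd Vs)| ≤ F * (Fintype.card n : ℝ) ^ (w + 1) := by
        refine (hlt Vs hV).trans ?_
        gcongr ?_ * ?_
        exact pow_le_pow_right₀ h1 hv
      have hself := M.abs_sum_der_wmat_le a 1 (M.traceProd Ws)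
        (B := F * (Fintype.card n : ℝ) ^ (w + 1)) (by positivity) W 1
        (fun V₁ V₂ hV => by
          simpa using hle ((bar V₁ ++ V₂) :: Ws) (by simp [hV]; omega)
            (by rw [hw, weight_cons, weight_cons]; split_ifs <;> omega))
        (fun V₁ V₂ hV => by
          have hdeg : deg (a :: W) = deg V₁ + deg V₂ := by
            rcases a with ⟨i, _ | _⟩ <;> simp [hV, opp] <;> ring
          simpa [mul_assoc] using hle (V₁ :: V₂ :: Ws) (by simp [hV]; omega)
            (by rw [hw, weight_cons, weight_cons, weight_cons]; split_ifs <;> omega))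
      have hcross := M.abs_sum_mul_der_traceProd_le_pow a W Ws hlt
      have hcross' : |∑ x, ∑ y, M.E (M.wmat W y x * M.der a x y (M.traceProd Ws))| ≤
          size Ws * (F * (Fintype.card n : ℝ) ^ (w + 1)) := by
        refine hcross.trans ?_
        gcongr ?_ * (?_ * ?_)
        refine pow_le_pow_right₀ h1 ?_
        rw [hw, weight_cons]
        omega
      rw [traceProd_cons, wmat_cons, E_trace_mat_mul, abs_mul, abs_of_nonneg (by positivity)]
      simp only [one_mul, mul_one] at hself
      have hcount : (W.length + size Ws : ℝ) * F ≤
          ((size ((a :: W) :: Ws)).doubleFactorial : ℝ) := by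
        rw [hF]
        have : size ((a :: W) :: Ws) = W.length + size Ws + 1 := by simp; omega
        rw [this]
        rcases hk : W.length + size Ws with _ | k
        · have : (W.length + size Ws : ℝ) = 0 := by exact_mod_cast hk
          simp [this]
        · have : (W.length + size Ws : ℝ) = k + 1 := by exact_mod_cast hk
          rw [this]
          simp only [Nat.add_sub_cancel, Nat.doubleFactorial_add_two]
          push_cast
          gcongr
          linarith
      calc _ ≤ (Fintype.card n : ℝ)⁻¹ * (W.length * (F * (Fintype.card n : ℝ) ^ (w + 1)) +
            size Ws * (F * (Fintype.card n : ℝ) ^ (w + 1))) := by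
            gcongr
            exact (abs_add_le _ _).trans (add_le_add hself hcross')
        _ = ((W.length + size Ws : ℝ) * F) * (Fintype.card n : ℝ) ^ w := by
            rw [pow_succ]
            field_simp
        _ ≤ _ := by gcongr

/-- Up to lower order terms, the trace of `A_J A_Iᵀ` may be replaced by `|n| δ_{I,J}`. -/
theorem abs_E_trace_sub_le (I J : List ι) (Ws : List (List (SignedLetter ι))) :
    |M.E ((M.wmat (pos J ++ bar (pos I))).trace * M.traceProd Ws) -
        Fintype.card n * (if I = J then 1 else 0) * M.E (M.traceProd Ws)| ≤
      (J.length + 1) * ((I.length + J.length + size Ws).doubleFactorial *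
        (Fintype.card n : ℝ) ^ weight Ws) := by
  have h1 := one_le_card (n := n)
  have unbalanced (I J : List ι) (h : I.length ≠ J.length) :
      |M.E ((M.wmat (pos J ++ bar (pos I))).trace * M.traceProd Ws)| ≤
      (J.length + 1) * ((I.length + J.length + size Ws).doubleFactorial *
        (Fintype.card n : ℝ) ^ weight Ws) := by
    have hb := M.abs_E_traceProd_le ((pos J ++ bar (pos I)) :: Ws)
    have hdeg : deg (pos J ++ bar (pos I)) ≠ 0 := by simp; omega
    rw [weight_cons, if_neg hdeg, zero_add, traceProd_cons] at hb
    simp only [size_cons, List.length_append, length_pos, length_bar,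
      add_comm J.length I.length] at hb
    refine hb.trans (le_mul_of_one_le_left (by positivity) ?_)
    linarith [(Nat.cast_nonneg J.length : (0 : ℝ) ≤ _)]
  induction J generalizing I with
  | nil =>
    cases I with
    | nil =>
      simp only [pos_nil, bar_nil, List.append_nil, wmat_nil, Matrix.trace_one, if_true, mul_one,
        ← nsmul_eq_mul, map_nsmul, sub_self, abs_zero]
      positivity
    | cons i I => simpa using unbalanced (i :: I) [] (by simp)
  | cons j J ih =>
    cases I with
    | nil => simpa using unbalanced [] (j :: J) (by simp)
    | cons i I =>
      have ih := ih I
      set w := weight Ws with hw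
      set F : ℝ := ((I.length + J.length + size Ws).doubleFactorial : ℝ) with hF
      set b : ℝ := (Fintype.card n : ℝ) with hb
      set Q := M.traceProd Ws with hQ
      have hle (Vs : List (List (SignedLetter ι))) (hV : size Vs = I.length + J.length + size Ws)
          (hv : weight Vs ≤ w + 1) : |M.E (M.traceProd Vs)| ≤ F * b ^ (w + 1) := by
        refine (M.abs_E_traceProd_le Vs).trans ?_
        rw [hV]
        gcongr ?_ * ?_
        exact pow_le_pow_right₀ h1 hv
      have hJ := M.abs_sum_der_wmat_le (j, true) (M.wmat (bar (pos I)) * M.mat (i, false)) Q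
        (B := F * b ^ (w + 1)) (by positivity) (pos J) 1
        (fun V₁ V₂ hV => by
          have hlen := congrArg List.length hV
          simpa using hle ((bar V₁ ++ (V₂ ++ (bar (pos I) ++ [(i, false)]))) :: Ws)
            (by simp at hlen ⊢; omega)
            (by rw [hw, weight_cons]; split_ifs <;> omega))
        (fun V₁ V₂ hV => by
          have := snd_of_mem_pos (I := J) (a := opp (j, true)) (by rw [hV]; simp)
          simp [opp] at this)
      have hI := M.abs_sum_der_wmat_le (j, true) (M.mat (i, false)) Q
        (B := F * b ^ (w + 1)) (by positivity) (bar (pos I)) (M.wmat (pos J))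
        (fun V₁ V₂ hV => by
          have hlen := congrArg List.length hV
          simpa [mul_assoc] using hle ((bar (pos J ++ V₁) ++ (V₂ ++ [(i, false)])) :: Ws)
            (by simp at hlen ⊢; omega)
            (by rw [hw, weight_cons]; split_ifs <;> omega))
        (fun V₁ V₂ hV => by
          have hlen := congrArg List.length hV
          have hneg : deg V₂ ≤ 0 := deg_nonpos fun a ha =>
            snd_of_mem_bar_pos (I := I) (by rw [hV]; simp [ha])
          have hdeg : deg (V₂ ++ [(i, false)]) ≠ 0 := by simp; omega
          simpa [mul_assoc] using hle ((pos J ++ V₁) :: (V₂ ++ [(i, false)]) :: Ws)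
            (by simp at hlen ⊢; omega)
            (by rw [hw, weight_cons, weight_cons, if_neg hdeg]; split_ifs <;> omega))
      have hcross := M.abs_sum_mul_der_traceProd_le_pow (j, true)
        (pos J ++ (bar (pos I) ++ [(i, false)])) Ws (fun Vs hV => by
          have hs : size Vs = (pos J ++ (bar (pos I) ++ [(i, false)])).length + size Ws - 1 := by
            omega
          rw [← hs]
          exact M.abs_E_traceProd_le Vs)
      have hlen : (pos J ++ (bar (pos I) ++ [(i, false)])).length + size Ws - 1 =
          I.length + J.length + size Ws := by simp; omega
      rw [hlen] at hcross
      have hlast := M.sum_der_mat (j, true) (i, false) (M.wmat (pos J) * M.wmat (bar (pos I))) 1 Q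
      set SJ := ∑ x, ∑ y, M.E ((1 * (M.wmat (pos J)).map (M.der (j, true) x y) *
        (M.wmat (bar (pos I)) * M.mat (i, false)) : Matrix n n R) y x * Q)
      set SI := ∑ x, ∑ y, M.E ((M.wmat (pos J) * (M.wmat (bar (pos I))).map (M.der (j, true) x y) *
        M.mat (i, false) : Matrix n n R) y x * Q)
      set SC := ∑ x, ∑ y, M.E (M.wmat (pos J ++ (bar (pos I) ++ [(i, false)])) y x *
        M.der (j, true) x y Q)
      set L := M.E ((M.wmat (pos J ++ bar (pos I))).trace * Q) with hL
      have hexp : M.E ((M.wmat (pos (j :: J) ++ bar (pos (i :: I)))).trace * Q) =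
          b⁻¹ * (SJ + SI + SC) + if i = j then L else 0 := by
        have hb0 : b ≠ 0 := by positivity
        have hlast' : b⁻¹ * (∑ x, ∑ y, M.E ((M.wmat (pos J) * M.wmat (bar (pos I)) *
            (M.mat (i, false)).map (M.der (j, true) x y) * 1 : Matrix n n R) y x * Q)) =
            if i = j then L else 0 := by
          rw [hlast]
          by_cases hij : i = j
          · have : (M.wmat (pos J) * M.wmat (bar (pos I))).trace * (1 : Matrix n n R).trace * Q =
                Fintype.card n • ((M.wmat (pos J ++ bar (pos I))).trace * Q) := by
              rw [Matrix.trace_one, nsmul_eq_mul, wmat_append]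
              ring
            rw [if_neg (by simp), if_pos (by simp [hij, opp]), if_pos hij, this, map_nsmul, ← hL,
              nsmul_eq_mul, ← hb, inv_mul_cancel_left₀ hb0]
          · simp [hij, opp]
        rw [← hlast', ← mul_add]
        have hword : pos (j :: J) ++ bar (pos (i :: I)) =
            (j, true) :: (pos J ++ (bar (pos I) ++ [(i, false)])) := by simp [opp]
        rw [hword, wmat_cons, E_trace_mat_mul]
        congr 1
        rw [add_right_comm]
        congr 1
        simp only [SJ, SI, ← Finset.sum_add_distrib, ← map_add, ← add_mul, ← Matrix.add_apply]
        simp only [wmat_append, wmat_cons, wmat_nil, map_derivation_mul]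
        simp only [mul_one, one_mul, mul_add, mul_assoc, add_assoc, map_derivation_one,
          mul_zero, add_zero]
      have hdelta : b * (if i :: I = j :: J then 1 else 0) * M.E Q =
          if i = j then b * (if I = J then 1 else 0) * M.E Q else 0 := by
        by_cases hij : i = j <;> simp [hij]
      have hd : (((i :: I).length + (j :: J).length + size Ws).doubleFactorial : ℝ) =
          (I.length + J.length + size Ws + 2) * F := by
        rw [show (i :: I).length + (j :: J).length + size Ws =
          I.length + J.length + size Ws + 2 by simp; omega, Nat.doubleFactorial_add_two]
        push_cast
        rfl
      have hmain : |b⁻¹ * (SJ + SI + SC)| ≤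
          ((i :: I).length + (j :: J).length + size Ws).doubleFactorial * b ^ w := by
        rw [abs_mul, abs_of_nonneg (by positivity)]
        have hsum : |SJ + SI + SC| ≤
            J.length * (F * b ^ (w + 1)) + I.length * (F * b ^ (w + 1)) +
              size Ws * (F * b ^ (w + 1)) := by
          refine (abs_add_three _ _ _).trans ?_
          simp only [length_pos, length_bar] at hI hJ
          gcongr
        rw [hd]
        calc _ ≤ b⁻¹ * _ := mul_le_mul_of_nonneg_left hsum (by positivity)
          _ = (I.length + J.length + size Ws + 0) * F * b ^ w := by
            rw [pow_succ]
            field_simp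
            ring
          _ ≤ _ := by gcongr; norm_num
      rw [hexp, hdelta]
      by_cases hij : i = j
      · simp only [hij, if_true]
        rw [add_sub_assoc]
        refine (abs_add_le _ _).trans ((add_le_add hmain ih).trans ?_)
        have hmono : F ≤ ((i :: I).length + (j :: J).length + size Ws).doubleFactorial := by
          rw [hd]
          refine le_mul_of_one_le_left (by positivity) ?_
          have : (0 : ℝ) ≤ I.length + J.length + size Ws := by positivity
          linarith
        have := mul_le_mul_of_nonneg_right hmono (by positivity : (0 : ℝ) ≤ b ^ w)
        push_cast [List.length_cons] at this ⊢
        nlinarith [(Nat.cast_nonneg J.length : (0 : ℝ) ≤ _)]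
      · simp only [hij, if_false, add_zero, sub_zero]
        refine hmain.trans (le_mul_of_one_le_left (by positivity) ?_)
        linarith [(Nat.cast_nonneg (j :: J).length : (0 : ℝ) ≤ _)]

end Bounds

section InitialVector

variable {h : n → R} {Dh : n → Derivation ℝ R R}

lemma E_quadratic_mul (hh : ∀ x y, Dh x (h y) = if y = x then 1 else 0)
    (hE : ∀ x p, M.E (h x * p) = M.E (Dh x p)) {A : Matrix n n R}
    (hA : ∀ x y z, Dh x (A y z) = 0) (p : R) :
    M.E ((h ⬝ᵥ A *ᵥ h) * p) = M.E (A.trace * p) + ∑ x, M.E ((A *ᵥ h) x * Dh x p) := by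
  have hd (x : n) : Dh x ((A *ᵥ h) x) = A x x := by
    simp [Matrix.mulVec, dotProduct, hA, hh]
  have : (h ⬝ᵥ A *ᵥ h) * p = ∑ x, h x * ((A *ᵥ h) x * p) := by
    simp [dotProduct, Finset.sum_mul, mul_assoc]
  simp only [this, map_sum, hE, Derivation.leibniz, smul_eq_mul, hd, map_add,
    Finset.sum_add_distrib, Matrix.trace, Matrix.diag, Finset.sum_mul]
  rw [add_comm]
  simp_rw [mul_comm p]

lemma E_quadratic (hh : ∀ x y, Dh x (h y) = if y = x then 1 else 0)
    (hE : ∀ x p, M.E (h x * p) = M.E (Dh x p)) {A : Matrix n n R}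
    (hA : ∀ x y z, Dh x (A y z) = 0) :
    M.E (h ⬝ᵥ A *ᵥ h) = M.E A.trace := by
  simpa using M.E_quadratic_mul hh hE hA 1

lemma E_quadratic_sq (hh : ∀ x y, Dh x (h y) = if y = x then 1 else 0)
    (hE : ∀ x p, M.E (h x * p) = M.E (Dh x p)) {A : Matrix n n R}
    (hA : ∀ x y z, Dh x (A y z) = 0) :
    M.E ((h ⬝ᵥ A *ᵥ h) ^ 2) =
      M.E (A.trace ^ 2) + M.E (Aᵀ * A).trace + M.E (A * A).trace := by
  have hAtr (x : n) : Dh x A.trace = 0 := by simp [Matrix.trace, hA]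
  have hmul (B C : Matrix n n R) (hB : ∀ x y z, Dh x (B y z) = 0)
      (hC : ∀ x y z, Dh x (C y z) = 0) (x y z : n) : Dh x ((B * C) y z) = 0 := by
    simp [Matrix.mul_apply, hB, hC]
  have hd (x : n) : Dh x (h ⬝ᵥ A *ᵥ h) = (A *ᵥ h) x + (Aᵀ *ᵥ h) x := by
    simp [Matrix.mulVec, dotProduct, hA, hh, Finset.sum_add_distrib, mul_comm]
    exact add_comm _ _
  have hAA : ∑ x, M.E ((A *ᵥ h) x * (A *ᵥ h) x) = M.E (Aᵀ * A).trace := by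
    rw [← M.E_quadratic hh hE (A := Aᵀ * A) (hmul Aᵀ A (fun x y z => hA x z y) hA), ← map_sum,
      ← Matrix.mulVec_mulVec, Matrix.dotProduct_mulVec h, Matrix.vecMul_transpose]
    rfl
  have hAA' : ∑ x, M.E ((A *ᵥ h) x * (Aᵀ *ᵥ h) x) = M.E (A * A).trace := by
    rw [← M.E_quadratic hh hE (hmul _ _ hA hA), ← map_sum,
      ← Matrix.mulVec_mulVec, Matrix.dotProduct_mulVec h, ← Matrix.mulVec_transpose,
      dotProduct_comm]
    rfl
  have htr : M.E (A.trace * (h ⬝ᵥ A *ᵥ h)) = M.E (A.trace ^ 2) := by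
    rw [mul_comm, M.E_quadratic_mul hh hE hA]
    simp [hAtr, pow_two]
  rw [pow_two, M.E_quadratic_mul hh hE hA, htr, add_assoc, ← hAA, ← hAA', ← Finset.sum_add_distrib]
  simp only [hd, mul_add, map_add]

lemma derivation_wmat {D : Derivation ℝ R R} (hX : ∀ i y z, D (M.X i y z) = 0)
    (W : List (SignedLetter ι)) (y z : n) : D (M.wmat W y z) = 0 := by
  induction W generalizing y with
  | nil => simpa using congrFun (congrFun (map_derivation_one (n := n) D) y) z
  | cons a W ih =>
    have ha (x : n) : D (M.mat a y x) = 0 := by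
      rcases a with ⟨i, _ | _⟩ <;> simp [mat, hX]
    simp [Matrix.mul_apply, ha, ih]

theorem E_normalized_quadratic_sub_sq_le [Nonempty n]
    (hh : ∀ x y, Dh x (h y) = if y = x then 1 else 0)
    (hE : ∀ x p, M.E (h x * p) = M.E (Dh x p))
    (hX : ∀ x i y z, Dh x (M.X i y z) = 0) (I J : List ι) :
    M.E (((Fintype.card n : ℝ)⁻¹ • (h ⬝ᵥ M.wmat (bar (pos I) ++ pos J) *ᵥ h) -
        (if I = J then 1 else 0 : ℝ) • 1) ^ 2) ≤
      4 * ((2 * (I.length + J.length)).doubleFactorial : ℝ) ^ 2 * (Fintype.card n : ℝ)⁻¹ := by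
  have h1 := one_le_card (n := n)
  set b : ℝ := (Fintype.card n : ℝ) with hb
  set δ : ℝ := if I = J then 1 else 0 with hδ
  have hδ0 : 0 ≤ δ := by rw [hδ]; split_ifs <;> norm_num
  have hδ1 : δ ≤ 1 := by rw [hδ]; split_ifs <;> norm_num
  set N := I.length + J.length with hN
  set V := pos J ++ bar (pos I) with hV
  set A := M.wmat (bar (pos I) ++ pos J) with hA
  have hA0 (x y z : n) : Dh x (A y z) = 0 := M.derivation_wmat (hX x) _ y z
  have htr : A.trace = (M.wmat V).trace := by
    rw [hA, hV, wmat_append, wmat_append, Matrix.trace_mul_comm]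
  have single_le (W : List (SignedLetter ι)) (hW : W.length = 2 * N) :
      M.E (M.wmat W).trace ≤ (2 * N).doubleFactorial * b := by
    have := M.abs_E_traceProd_le [W]
    simp only [traceProd_cons, traceProd_nil, mul_one, size_cons, size_nil, add_zero, hW] at this
    refine (le_abs_self _).trans (this.trans ?_)
    gcongr ?_ * ?_
    calc b ^ weight [W] ≤ b ^ 1 := pow_le_pow_right₀ h1 (by
          rw [weight_cons, weight_nil]; split_ifs <;> omega)
      _ = b := pow_one b
  have hsq := M.E_quadratic_sq hh hE hA0
  have hlin := M.E_quadratic hh hE hA0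
  have e1 := M.abs_E_trace_sub_le I J [V]
  have e0 := M.abs_E_trace_sub_le I J []
  have s1 : M.E (Aᵀ * A).trace ≤ (2 * N).doubleFactorial * b := by
    have := single_le (bar (bar (pos I) ++ pos J) ++ (bar (pos I) ++ pos J)) (by simp [hN]; omega)
    rwa [wmat_append, wmat_bar] at this
  have s2 : M.E (A * A).trace ≤ (2 * N).doubleFactorial * b := by
    have := single_le ((bar (pos I) ++ pos J) ++ (bar (pos I) ++ pos J)) (by simp [hN]; omega)
    rwa [wmat_append] at this
  simp only [← hV, ← hN, ← hb, ← hδ, traceProd_cons, traceProd_nil, mul_one, size_cons, size_nil,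
    add_zero, weight_nil, pow_zero, M.E_one, ← pow_two, ← htr] at e0 e1
  have hVl : N + V.length = 2 * N := by simp [hV, hN]; omega
  rw [hVl] at e1
  have e1' : M.E (A.trace ^ 2) - b * δ * M.E A.trace ≤
      (J.length + 1) * ((2 * N).doubleFactorial * b) := by
    refine (le_abs_self _).trans (e1.trans ?_)
    gcongr
    calc b ^ weight [V] ≤ b ^ 1 := pow_le_pow_right₀ h1 (by
          rw [weight_cons, weight_nil]; split_ifs <;> omega)
      _ = b := pow_one b
  have hNN : (N.doubleFactorial : ℝ) ≤ (2 * N).doubleFactorial := by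
    rw [Nat.doubleFactorial_two_mul]
    exact_mod_cast (Nat.doubleFactorial_le_factorial N).trans
      (Nat.le_mul_of_pos_left _ (by positivity))
  have e0' : -(b * δ * (M.E A.trace - b * δ)) ≤
      (J.length + 1) * ((2 * N).doubleFactorial * b) := by
    calc -(b * δ * (M.E A.trace - b * δ)) ≤ |b * δ * (M.E A.trace - b * δ)| := neg_le_abs _
      _ = b * δ * |M.E A.trace - b * δ| := by rw [abs_mul, abs_of_nonneg (by positivity)]
      _ ≤ b * 1 * ((J.length + 1) * N.doubleFactorial) := by gcongr
      _ ≤ b * 1 * ((J.length + 1) * (2 * N).doubleFactorial) := by gcongr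
      _ = _ := by ring
  have hexp : M.E ((b⁻¹ • (h ⬝ᵥ A *ᵥ h) - δ • 1) ^ 2) =
      b⁻¹ ^ 2 * (M.E ((h ⬝ᵥ A *ᵥ h) ^ 2) - 2 * b * δ * M.E (h ⬝ᵥ A *ᵥ h) + (b * δ) ^ 2) := by
    have : (b⁻¹ • (h ⬝ᵥ A *ᵥ h) - δ • (1 : R)) ^ 2 = (b⁻¹ ^ 2) • (h ⬝ᵥ A *ᵥ h) ^ 2 -
        (2 * b⁻¹ * δ) • (h ⬝ᵥ A *ᵥ h) + (δ ^ 2) • (1 : R) := by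
      simp only [Algebra.smul_def, map_mul, map_pow, map_ofNat]
      ring
    rw [this, map_add, map_sub]
    simp only [map_smul, smul_eq_mul, M.E_one]
    field_simp
  have hcount : (2 * (J.length + 1) + 2 : ℝ) ≤ 4 * (2 * N).doubleFactorial := by
    have : J.length + 2 ≤ 2 * (2 * N).doubleFactorial := by
      rw [Nat.doubleFactorial_two_mul]
      have h2 : N < 2 ^ N := Nat.lt_two_pow_self
      have := Nat.le_mul_of_pos_right (2 ^ N) (Nat.factorial_pos N)
      have := Nat.one_le_two_pow (n := N)
      omega
    have : (J.length + 2 : ℝ) ≤ 2 * (2 * N).doubleFactorial := by exact_mod_cast this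
    linarith
  rw [hexp, hsq, hlin]
  calc _ ≤ b⁻¹ ^ 2 * ((2 * (J.length + 1) + 2 : ℝ) * ((2 * N).doubleFactorial * b)) := by
        gcongr
        linarith
    _ ≤ b⁻¹ ^ 2 * ((4 * (2 * N).doubleFactorial) * ((2 * N).doubleFactorial * b)) := by
        gcongr
    _ = _ := by
        field_simp

end InitialVector

end GaussianMatrixModel

section Moments

open scoped NNReal

lemma integrable_pow_gaussianReal (v : ℝ≥0) (n : ℕ) :
    Integrable (fun x => x ^ n) (gaussianReal 0 v) := by
  rw [← integrable_norm_iff (by fun_prop)]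
  simpa using (memLp_id_gaussianReal (μ := 0) (v := v) (n : ℝ≥0)).integrable_norm_pow'

lemma integrable_pow_mul_gaussianPDFReal {v : ℝ≥0} (hv : v ≠ 0) (n : ℕ) :
    Integrable fun x => x ^ n * gaussianPDFReal 0 v x := by
  have h := integrable_pow_gaussianReal v n
  rw [gaussianReal_of_var_ne_zero _ hv, integrable_withDensity_iff (measurable_gaussianPDF _ _)
    (ae_of_all _ fun _ => gaussianPDF_lt_top)] at h
  simpa using h

lemma hasDerivAt_gaussianPDFReal {v : ℝ≥0} (hv : v ≠ 0) (x : ℝ) :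
    HasDerivAt (gaussianPDFReal 0 v) (-(v : ℝ)⁻¹ * (x * gaussianPDFReal 0 v x)) x := by
  have hv' : (v : ℝ) ≠ 0 := by exact_mod_cast hv
  have := ((((hasDerivAt_id x).pow 2).neg.div_const (2 * v : ℝ)).exp).const_mul
    (Real.sqrt (2 * Real.pi * v))⁻¹
  rw [gaussianPDFReal_def]
  simp only [sub_zero]
  refine this.congr_deriv ?_
  simp
  field_simp

/-- Gaussian integration by parts for monomials. -/
lemma integral_pow_succ_gaussianReal {v : ℝ≥0} (hv : v ≠ 0) (n : ℕ) :
    ∫ x, x ^ (n + 1) ∂gaussianReal 0 v = v * (n * ∫ x, x ^ (n - 1) ∂gaussianReal 0 v) := by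
  have hv' : (v : ℝ) ≠ 0 := by exact_mod_cast hv
  have key := integral_mul_deriv_eq_deriv_mul_of_integrable
    (u := fun x => x ^ n) (u' := fun x => n * x ^ (n - 1)) (v := gaussianPDFReal 0 v)
    (fun x _ => hasDerivAt_pow n x) (fun x _ => hasDerivAt_gaussianPDFReal hv x)
    (((integrable_pow_mul_gaussianPDFReal hv (n + 1)).const_mul (-(v : ℝ)⁻¹)).congr
      (ae_of_all _ fun x => by simp only [Pi.mul_apply]; ring))
    (((integrable_pow_mul_gaussianPDFReal hv (n - 1)).const_mul (n : ℝ)).congr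
      (ae_of_all _ fun x => by simp only [Pi.mul_apply]; ring))
    (integrable_pow_mul_gaussianPDFReal hv n)
  rw [integral_gaussianReal_eq_integral_smul hv, integral_gaussianReal_eq_integral_smul hv]
  have e1 (x : ℝ) : x ^ n * (-(v : ℝ)⁻¹ * (x * gaussianPDFReal 0 v x)) =
      -(v : ℝ)⁻¹ * (gaussianPDFReal 0 v x • x ^ (n + 1)) := by simp only [smul_eq_mul]; ring
  have e2 (x : ℝ) : n * x ^ (n - 1) * gaussianPDFReal 0 v x =
      n * (gaussianPDFReal 0 v x • x ^ (n - 1)) := by simp only [smul_eq_mul]; ring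
  simp_rw [e1, e2, integral_const_mul] at key
  field_simp at key ⊢
  linarith

end Moments

section PolynomialExpectation

open scoped NNReal

/-- The real random variables `pt · s` have the mixed moments of independent centred Gaussians
with variances `v s`. -/
def HasGaussianMoments {Ω σ : Type*} [Fintype σ] [MeasurableSpace Ω] (μ : Measure Ω)
    (pt : Ω → σ → ℝ) (v : σ → ℝ≥0) : Prop :=
  ∀ e : σ → ℕ, Integrable (fun ω => ∏ s, pt ω s ^ e s) μ ∧
    ∫ ω, ∏ s, pt ω s ^ e s ∂μ = ∏ s, ∫ x, x ^ e s ∂gaussianReal 0 (v s)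

namespace HasGaussianMoments

variable {Ω σ : Type*} [Fintype σ] [MeasurableSpace Ω] {μ : Measure Ω}
  {pt : Ω → σ → ℝ} {v : σ → ℝ≥0}

lemma eval_monomial (x : σ → ℝ) (e : σ →₀ ℕ) (a : ℝ) :
    MvPolynomial.eval x (MvPolynomial.monomial e a) = a * ∏ s, x s ^ e s := by
  rw [MvPolynomial.eval_monomial, Finsupp.prod_fintype _ _ (by simp)]

lemma integrable_eval (H : HasGaussianMoments μ pt v) (p : MvPolynomial σ ℝ) :
    Integrable (fun ω => MvPolynomial.eval (pt ω) p) μ := by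
  induction p using MvPolynomial.induction_on' with
  | monomial e a =>
    simp only [eval_monomial]
    exact (H e).1.const_mul a
  | add p q hp hq =>
    simp only [map_add]
    exact hp.add hq

/-- Expectation as a linear functional on polynomials in the random variables. -/
def expectation (H : HasGaussianMoments μ pt v) : MvPolynomial σ ℝ →ₗ[ℝ] ℝ where
  toFun p := ∫ ω, MvPolynomial.eval (pt ω) p ∂μ
  map_add' p q := by simpa using integral_add (H.integrable_eval p) (H.integrable_eval q)
  map_smul' a p := by simp [integral_const_mul]

lemma expectation_apply (H : HasGaussianMoments μ pt v) (p : MvPolynomial σ ℝ) :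
    H.expectation p = ∫ ω, MvPolynomial.eval (pt ω) p ∂μ := rfl

lemma expectation_monomial (H : HasGaussianMoments μ pt v) (e : σ →₀ ℕ) (a : ℝ) :
    H.expectation (MvPolynomial.monomial e a) =
      a * ∏ s, ∫ x, x ^ e s ∂gaussianReal 0 (v s) := by
  simp only [expectation_apply, eval_monomial, integral_const_mul, (H e).2]

lemma expectation_X_mul [DecidableEq σ] (H : HasGaussianMoments μ pt v) {s : σ} (hs : v s ≠ 0)
    (p : MvPolynomial σ ℝ) :
    H.expectation (MvPolynomial.X s * p) = v s * H.expectation (MvPolynomial.pderiv s p) := by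
  induction p using MvPolynomial.induction_on' with
  | monomial e a =>
    rw [MvPolynomial.X, MvPolynomial.monomial_mul, MvPolynomial.pderiv_monomial,
      expectation_monomial, expectation_monomial, ← Finset.mul_prod_erase _ _ (Finset.mem_univ s),
      ← Finset.mul_prod_erase _ _ (Finset.mem_univ s)]
    have hne (f : σ →₀ ℕ) (hf : ∀ t ≠ s, f t = e t) :
        ∏ t ∈ Finset.univ.erase s, ∫ x, x ^ f t ∂gaussianReal 0 (v t) =
          ∏ t ∈ Finset.univ.erase s, ∫ x, x ^ e t ∂gaussianReal 0 (v t) :=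
      Finset.prod_congr rfl fun t ht => by rw [hf t (Finset.ne_of_mem_erase ht)]
    rw [hne (Finsupp.single s 1 + e) (fun t ht => by simp [ht.symm]),
      hne (e - Finsupp.single s 1) (fun t ht => by simp [ht.symm])]
    simp only [Finsupp.coe_add, Finsupp.coe_tsub, Pi.add_apply, Pi.sub_apply,
      Finsupp.single_eq_same, add_comm 1, integral_pow_succ_gaussianReal hs]
    ring
  | add p q hp hq => rw [mul_add, map_add, hp, hq, map_add, map_add, mul_add]

lemma pi_gaussianReal {σ : Type*} [Fintype σ] (v : σ → ℝ≥0) :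
    HasGaussianMoments (Measure.pi fun s => gaussianReal 0 (v s)) (fun ω => ω) v :=
  fun e => ⟨Integrable.fintype_prod fun s => integrable_pow_gaussianReal (v s) (e s),
    integral_fintype_prod_eq_prod fun s x => x ^ e s⟩

lemma pi {ι : Type*} [Fintype ι] [SigmaFinite μ] (H : HasGaussianMoments μ pt v) :
    HasGaussianMoments (Measure.pi fun _ : ι => μ) (fun ω (q : ι × σ) => pt (ω q.1) q.2)
      (fun q => v q.2) := by
  intro e
  simp only [Fintype.prod_prod_type]
  refine ⟨Integrable.fintype_prod fun i => (H fun s => e (i, s)).1, ?_⟩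
  rw [integral_fintype_prod_eq_prod fun i x => ∏ s, pt x s ^ e (i, s)]
  exact Finset.prod_congr rfl fun i _ => (H fun s => e (i, s)).2

lemma prod {Ω' τ : Type*} [Fintype τ] [MeasurableSpace Ω'] {μ' : Measure Ω'} [SFinite μ]
    [SFinite μ'] {pt' : Ω' → τ → ℝ} {v' : τ → ℝ≥0} (H : HasGaussianMoments μ pt v)
    (H' : HasGaussianMoments μ' pt' v') :
    HasGaussianMoments (μ.prod μ') (fun ω => Sum.elim (pt ω.1) (pt' ω.2)) (Sum.elim v v') := by
  intro e
  simp only [Fintype.prod_sum_type, Sum.elim_inl, Sum.elim_inr]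
  have h := H fun s => e (.inl s)
  have h' := H' fun s => e (.inr s)
  exact ⟨h.1.mul_prod h'.1, by rw [integral_prod_mul
    (fun x => ∏ s, pt x s ^ e (.inl s)) (fun y => ∏ t, pt' y t ^ e (.inr t)), h.2, h'.2]⟩

end HasGaussianMoments

end PolynomialExpectation

section BlockModel

open scoped NNReal

variable {d k b : ℕ}

/-- Indices of the random entries of the block-diagonal model. -/
abbrev BlockIndex (d k b : ℕ) : Type :=
  (Fin d × Fin k × Fin b × Fin b) ⊕ (Fin b × Fin k)

/-- The random entries of the block-diagonal model, as one family. -/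
def blockEntries (ω : BlockOmega d k b) : BlockIndex d k b → ℝ :=
  Sum.elim (fun q => ω.1 q.1 q.2.1 q.2.2.1 q.2.2.2) ω.2

instance : IsProbabilityMeasure (blockMeasure d k b) := by
  unfold blockMeasure
  infer_instance

lemma hasGaussianMoments_blockMeasure :
    HasGaussianMoments (blockMeasure d k b) blockEntries
      (Sum.elim (fun _ => 1 / (b : ℝ≥0)) fun _ => 1) :=
  (HasGaussianMoments.pi_gaussianReal (fun _ : Fin b => 1 / (b : ℝ≥0))).pi.pi.pi.prod
    (HasGaussianMoments.pi_gaussianReal fun _ : Fin b × Fin k => (1 : ℝ≥0))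

/-- The polynomial model of the `l`-th block. -/
def blockModel (hb : b ≠ 0) (l : Fin k) :
    GaussianMatrixModel (Fin d) (Fin b) (MvPolynomial (BlockIndex d k b) ℝ) where
  E := hasGaussianMoments_blockMeasure.expectation
  X i := Matrix.of fun x y => MvPolynomial.X (.inl (i, l, x, y))
  D i x y := MvPolynomial.pderiv (.inl (i, l, x, y))
  E_one := by simp [HasGaussianMoments.expectation_apply]
  D_X i j x y z w := by
    simp only [Matrix.of_apply, MvPolynomial.pderiv_X, Pi.single_apply]
    simp [eq_comm]
  E_X_mul i x y p := by
    rw [Matrix.of_apply, HasGaussianMoments.expectation_X_mul _ (by simpa using hb)]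
    simp

/-- The `l`-th block of the initial vector, as polynomials. -/
def blockInit (d : ℕ) {k b : ℕ} (l : Fin k) (x : Fin b) : MvPolynomial (BlockIndex d k b) ℝ :=
  MvPolynomial.X (.inr (x, l))

/-- The `l`-th block of the inner product of two features, as a polynomial. -/
def blockForm (hb : b ≠ 0) (I J : List (Fin d)) (l : Fin k) : MvPolynomial (BlockIndex d k b) ℝ :=
  blockInit d l ⬝ᵥ (blockModel hb l).wmat (SignedLetter.bar (SignedLetter.pos I) ++
    SignedLetter.pos J) *ᵥ blockInit d l

lemma wordProd_blockA (ω : BlockOmega d k b) (I : List (Fin d)) :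
    wordProd (blockA ω) I =
      Matrix.blockDiagonal fun l => wordProd (fun i => Matrix.of (ω.1 i l)) I := by
  induction I with
  | nil => exact (Matrix.blockDiagonal_one (m := Fin b) (o := Fin k) (α := ℝ)).symm
  | cons i I ih =>
    simp only [wordProd, List.map_cons, List.prod_cons] at ih ⊢
    rw [ih, blockA, ← Matrix.blockDiagonal_mul]

lemma blockFeature_apply (ω : BlockOmega d k b) (I : List (Fin d)) (x : Fin b) (l : Fin k) :
    blockFeature I ω (x, l) =
      (wordProd (fun i => Matrix.of (ω.1 i l)) I *ᵥ fun y => ω.2 (y, l)) x := by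
  simp [blockFeature, wordProd_blockA, Matrix.mulVec, dotProduct, Fintype.sum_prod_type,
    Matrix.blockDiagonal_apply]

lemma map_wmat_pos (hb : b ≠ 0) (ω : BlockOmega d k b) (I : List (Fin d)) (l : Fin k) :
    ((blockModel hb l).wmat (SignedLetter.pos I)).map (MvPolynomial.eval (blockEntries ω)) =
      wordProd (fun i => Matrix.of (ω.1 i l)) I := by
  induction I with
  | nil => simp [wordProd]
  | cons i I ih =>
    simp only [wordProd, List.map_cons, List.prod_cons] at ih ⊢
    rw [SignedLetter.pos_cons, GaussianMatrixModel.wmat_cons, Matrix.map_mul, ih]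
    congr 1
    ext x y
    simp [GaussianMatrixModel.mat, blockModel, blockEntries]

lemma eval_blockForm (hb : b ≠ 0) (ω : BlockOmega d k b) (I J : List (Fin d)) (l : Fin k) :
    MvPolynomial.eval (blockEntries ω) (blockForm hb I J l) =
      ∑ x, blockFeature I ω (x, l) * blockFeature J ω (x, l) := by
  simp only [blockFeature_apply, ← map_wmat_pos hb]
  rw [blockForm, GaussianMatrixModel.wmat_append, GaussianMatrixModel.wmat_bar,
    ← Matrix.mulVec_mulVec, Matrix.dotProduct_mulVec, Matrix.vecMul_transpose]
  simp [dotProduct, Matrix.mulVec, blockInit, blockEntries]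

lemma expectation_blockForm_sub_sq_le (hb : b ≠ 0) (I J : List (Fin d)) (l : Fin k) :
    ∫ ω, ((b : ℝ)⁻¹ * MvPolynomial.eval (blockEntries ω) (blockForm hb I J l) -
        wordDelta I J) ^ 2 ∂blockMeasure d k b ≤
      4 * ((2 * (I.length + J.length)).doubleFactorial : ℝ) ^ 2 * (b : ℝ)⁻¹ := by
  have : NeZero b := ⟨hb⟩
  have h := (blockModel hb l).E_normalized_quadratic_sub_sq_le (h := blockInit d l)
    (Dh := fun x => MvPolynomial.pderiv (.inr (x, l)))
    (fun x y => by
      simp only [blockInit, MvPolynomial.pderiv_X, Pi.single_apply]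
      simp [eq_comm])
    (fun x p => by
      have := (hasGaussianMoments_blockMeasure (d := d) (k := k) (b := b)).expectation_X_mul
        (s := .inr (x, l)) (by simp) p
      simpa [blockModel, blockInit] using this)
    (fun x i y z => by simp [blockModel, MvPolynomial.pderiv_X]) I J
  simpa [blockModel, HasGaussianMoments.expectation_apply, wordDelta, blockForm] using h

lemma sq_normalized_dotProduct_sub_le (hk : k ≠ 0) (hb : b ≠ 0) (ω : BlockOmega d k b)
    (I J : List (Fin d)) :
    (((k * b : ℕ) : ℝ)⁻¹ * (blockFeature I ω ⬝ᵥ blockFeature J ω) - wordDelta I J) ^ 2 ≤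
      (k : ℝ)⁻¹ * ∑ l, ((b : ℝ)⁻¹ * MvPolynomial.eval (blockEntries ω) (blockForm hb I J l) -
        wordDelta I J) ^ 2 := by
  have hk' : (k : ℝ) ≠ 0 := by exact_mod_cast hk
  have hb' : (b : ℝ) ≠ 0 := by exact_mod_cast hb
  have hsum : ((k * b : ℕ) : ℝ)⁻¹ * (blockFeature I ω ⬝ᵥ blockFeature J ω) - wordDelta I J =
      (k : ℝ)⁻¹ * ∑ l, ((b : ℝ)⁻¹ * MvPolynomial.eval (blockEntries ω) (blockForm hb I J l) -
        wordDelta I J) := by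
    rw [Finset.sum_sub_distrib, ← Finset.mul_sum, dotProduct, Fintype.sum_prod_type_right]
    simp only [eval_blockForm, Finset.sum_const, Finset.card_univ, Fintype.card_fin, nsmul_eq_mul]
    push_cast
    field_simp
  have hcs := sq_sum_le_card_mul_sum_sq (s := Finset.univ) (f := fun l : Fin k =>
    (b : ℝ)⁻¹ * MvPolynomial.eval (blockEntries ω) (blockForm hb I J l) - wordDelta I J)
  rw [Finset.card_univ, Fintype.card_fin] at hcs
  rw [hsum, mul_pow]
  calc _ ≤ (k : ℝ)⁻¹ ^ 2 * _ := mul_le_mul_of_nonneg_left hcs (by positivity)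
    _ = _ := by field_simp

lemma integral_sq_normalized_dotProduct_sub_le (hk : k ≠ 0) (hb : b ≠ 0) (I J : List (Fin d)) :
    ∫ ω, (((k * b : ℕ) : ℝ)⁻¹ * (blockFeature I ω ⬝ᵥ blockFeature J ω) - wordDelta I J) ^ 2
        ∂blockMeasure d k b ≤
      4 * ((2 * (I.length + J.length)).doubleFactorial : ℝ) ^ 2 * (b : ℝ)⁻¹ := by
  have hint (l : Fin k) : Integrable (fun ω => ((b : ℝ)⁻¹ *
      MvPolynomial.eval (blockEntries ω) (blockForm hb I J l) - wordDelta I J) ^ 2)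
      (blockMeasure d k b) := by
    have := hasGaussianMoments_blockMeasure.integrable_eval
      ((MvPolynomial.C (b : ℝ)⁻¹ * blockForm hb I J l - MvPolynomial.C (wordDelta I J)) ^ 2)
    simpa only [map_pow, map_sub, map_mul, MvPolynomial.eval_C] using this
  have hk' : (k : ℝ) ≠ 0 := by exact_mod_cast hk
  calc _ ≤ ∫ ω, (k : ℝ)⁻¹ * ∑ l, ((b : ℝ)⁻¹ * MvPolynomial.eval (blockEntries ω)
          (blockForm hb I J l) - wordDelta I J) ^ 2 ∂blockMeasure d k b :=
        integral_mono_of_nonneg (ae_of_all _ fun _ => sq_nonneg _)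
          ((integrable_finsetSum _ fun l _ => hint l).const_mul _)
          (ae_of_all _ fun ω => sq_normalized_dotProduct_sub_le hk hb ω I J)
    _ ≤ (k : ℝ)⁻¹ * ∑ _l : Fin k,
          4 * ((2 * (I.length + J.length)).doubleFactorial : ℝ) ^ 2 * (b : ℝ)⁻¹ := by
        rw [integral_const_mul, integral_finsetSum _ fun l _ => hint l]
        gcongr with l
        exact expectation_blockForm_sub_sq_le hb I J l
    _ = _ := by
        simp only [Finset.sum_const, Finset.card_univ, Fintype.card_fin, nsmul_eq_mul]
        field_simp

end BlockModel

/-- **Key moment bound for the block-diagonal model.**  There are universal constants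
`κ ≥ 1` and `c > 0` such that for all `d, k, b ≥ 1` (with `N = k⬝b`) and all words
`I, J` over `{1,…,d}`,
`E[((1/N)⟨A_I h₀, A_J h₀⟩ - δ_{I,J})²]^{1/2} ≤ (κ(|I|+|J|))!! ⬝ c / √b`. -/
theorem blockdiag_moment_bound :
    ∃ (κ : ℕ) (c : ℝ), 1 ≤ κ ∧ 0 < c ∧
      ∀ (d k b : ℕ), 1 ≤ d → 1 ≤ k → 1 ≤ b →
        ∀ (I J : List (Fin d)),
          Real.sqrt (∫ ω, (((k * b : ℕ) : ℝ)⁻¹ * (blockFeature I ω ⬝ᵥ blockFeature J ω)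
                - wordDelta I J) ^ 2 ∂(blockMeasure d k b))
            ≤ (Nat.doubleFactorial (κ * (I.length + J.length)) : ℝ) * (c / Real.sqrt b) := by
  refine ⟨2, 2, by norm_num, by norm_num, fun d k b _ hk hb I J => ?_⟩
  refine Real.sqrt_le_iff.mpr ⟨by positivity, ?_⟩
  refine (integral_sq_normalized_dotProduct_sub_le (by omega) (by omega) I J).trans_eq ?_
  rw [mul_pow, div_pow, Real.sq_sqrt (Nat.cast_nonneg b), div_eq_mul_inv]
  ring

end
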